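/- Let u₀ be a position vector of length M and let n ≥ 0 be an integer. For every sequence (w₁, …, w_n) where each w_i is either the operation ODD or the operation EVEN, the position vector w_n(w_{n−1}(⋯ w_1(u₀) ⋯)) is ≤ ODD^n(u₀) in the partial order on position vectors. (Consequently, when Paul always asks the alternating question in the pathological liar game, Carole's best strategy is to always move the odd-indexed elements.) -/

import Mathlib

/-- The (weak majorization) partial order on position vectors:
`u ≤ v` iff every prefix sum of `u` is at most the corresponding prefix sum of `v`. -/
def PosLE {M : ℕ} (u v : Fin M → ℕ) : Prop :=
  ∀ k : Fin M, ∑ j ∈ Finset.Iic k, u j ≤ ∑ j ∈ Finset.Iic k, v j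

/-- The nondecreasing rearrangement of a vector. -/
def sortVec {M : ℕ} (u : Fin M → ℕ) : Fin M → ℕ := u ∘ Tuple.sort u

/-- `ODD(u)`: add one to every odd-indexed entry (1-based: indices 1,3,5,…; these are the
entries with even 0-based index) and rearrange in nondecreasing order. -/
def oddMove {M : ℕ} (u : Fin M → ℕ) : Fin M → ℕ :=
  sortVec (fun i => u i + if (i : ℕ) % 2 = 0 then 1 else 0)

/-- `EVEN(u)`: add one to every even-indexed entry (1-based: indices 2,4,6,…; these are the
entries with odd 0-based index) and rearrange in nondecreasing order. -/
def evenMove {M : ℕ} (u : Fin M → ℕ) : Fin M → ℕ :=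
  sortVec (fun i => u i + if (i : ℕ) % 2 = 1 then 1 else 0)

/-- Apply the sequence of moves `w 0, w 1, …, w (n-1)` (where `true` stands for `ODD` and
`false` for `EVEN`) to the position vector `u₀`. -/
def applySeq {M : ℕ} (u₀ : Fin M → ℕ) (w : ℕ → Bool) : ℕ → Fin M → ℕ
  | 0 => u₀
  | n + 1 => if w n then oddMove (applySeq u₀ w n) else evenMove (applySeq u₀ w n)

def FF {M : ℕ} (u : Fin M → ℕ) (t : ℕ) : ℕ := ∑ i, (t - u i)

theorem FF_sort {M : ℕ} (u : Fin M → ℕ) (t : ℕ) : FF (sortVec u) t = FF u t := by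
  unfold FF sortVec
  exact Equiv.sum_comp (Tuple.sort u) (fun i => t - u i)

theorem sortVec_mono {M : ℕ} (u : Fin M → ℕ) : Monotone (sortVec u) :=
  Tuple.monotone_sort u

theorem alt_count (g : ℕ → ℕ) (hg : Antitone g) (h1 : ∀ i, g i ≤ 1) (n : ℕ) :
    let c := ∑ i ∈ Finset.range n, (if i % 2 = 0 then g i else 0)
    let f := ∑ i ∈ Finset.range n, (if i % 2 = 1 then g i else 0)
    (c = (n + 1) / 2 ∧ f = n / 2) ∨ (f ≤ c ∧ c ≤ f + 1 ∧ g n = 0) := by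
  induction n with
  | zero => simp
  | succ n ih =>
    simp only [Finset.sum_range_succ] at ih ⊢
    have h2 := h1 n
    have h3 := hg (Nat.le_succ n)
    have h4 := h1 (n + 1)
    simp only [Nat.succ_eq_add_one] at h3
    rcases Nat.mod_two_eq_zero_or_one n with h | h <;> simp only [h] <;> simp <;> omega

theorem fin_count {M : ℕ} (u : Fin M → ℕ) (hu : Monotone u) (t : ℕ) :
    (∑ i : Fin M, if (i : ℕ) % 2 = 1 then (if u i ≤ t then 1 else 0) else 0)
      ≤ (∑ i : Fin M, if (i : ℕ) % 2 = 0 then (if u i ≤ t then 1 else 0) else 0) ∧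
    (∑ i : Fin M, if (i : ℕ) % 2 = 0 then (if u i ≤ t then 1 else 0) else 0)
      ≤ (∑ i : Fin M, if (i : ℕ) % 2 = 1 then (if u i ≤ t then 1 else 0) else 0) + 1 := by
  let g : ℕ → ℕ := fun i => if h : i < M then (if u ⟨i, h⟩ ≤ t then 1 else 0) else 0
  have hg : Antitone g := by
    intro a b hab
    simp only [g]
    by_cases hb : b < M
    · have ha : a < M := by omega
      have := hu (show (⟨a, ha⟩ : Fin M) ≤ ⟨b, hb⟩ from hab)
      simp only [ha, hb, dite_true]
      split_ifs <;> omega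
    · simp [hb]
  have h1 : ∀ i, g i ≤ 1 := by
    intro i
    simp only [g]
    split_ifs <;> omega
  have key := alt_count g hg h1 M
  have e (r : ℕ) : ∑ i ∈ Finset.range M, (if i % 2 = r then g i else 0)
      = ∑ i : Fin M, if (i : ℕ) % 2 = r then (if u i ≤ t then 1 else 0) else 0 := by
    rw [Finset.sum_range]
    apply Finset.sum_congr rfl
    intro i _
    simp [g]
  simp only [e] at key
  omega

theorem FF_split {M : ℕ} (u : Fin M → ℕ) (t : ℕ) :
    FF u (t + 1) = FF u t
      + (∑ i : Fin M, if (i : ℕ) % 2 = 0 then (if u i ≤ t then 1 else 0) else 0)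
      + (∑ i : Fin M, if (i : ℕ) % 2 = 1 then (if u i ≤ t then 1 else 0) else 0) := by
  unfold FF
  rw [← Finset.sum_add_distrib, ← Finset.sum_add_distrib]
  apply Finset.sum_congr rfl
  intro i _
  split_ifs <;> omega

theorem FF_odd {M : ℕ} (u : Fin M → ℕ) (hu : Monotone u) (t : ℕ) :
    FF (oddMove u) (t + 1) = (FF u t + FF u (t + 1)) / 2 := by
  have h : FF (oddMove u) (t + 1) = FF u t
      + (∑ i : Fin M, if (i : ℕ) % 2 = 1 then (if u i ≤ t then 1 else 0) else 0) := by
    unfold oddMove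
    rw [FF_sort]
    unfold FF
    rw [← Finset.sum_add_distrib]
    apply Finset.sum_congr rfl
    intro i _
    beta_reduce
    split_ifs <;> omega
  have := fin_count u hu t
  have := FF_split u t
  omega

theorem FF_even {M : ℕ} (u : Fin M → ℕ) (hu : Monotone u) (t : ℕ) :
    FF (evenMove u) (t + 1) = (FF u t + FF u (t + 1) + 1) / 2 := by
  have h : FF (evenMove u) (t + 1) = FF u t
      + (∑ i : Fin M, if (i : ℕ) % 2 = 0 then (if u i ≤ t then 1 else 0) else 0) := by
    unfold evenMove
    rw [FF_sort]
    unfold FF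
    rw [← Finset.sum_add_distrib]
    apply Finset.sum_congr rfl
    intro i _
    beta_reduce
    split_ifs <;> omega
  have := fin_count u hu t
  have := FF_split u t
  omega

theorem posLE_of_FF {M : ℕ} (u v : Fin M → ℕ) (hu : Monotone u)
    (h : ∀ t, FF v t ≤ FF u t) : PosLE u v := by
  intro k
  have h1 : FF u (u k) = ∑ j ∈ Finset.Iic k, (u k - u j) := by
    unfold FF
    symm
    apply Finset.sum_subset (Finset.subset_univ _)
    intro j _ hj
    have : k ≤ j := by
      simp only [Finset.mem_Iic, not_le] at hj
      exact hj.le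
    have := hu this
    omega
  have h2 : ∑ j ∈ Finset.Iic k, (u k - v j) ≤ FF v (u k) :=
    Finset.sum_le_sum_of_subset (Finset.subset_univ _)
  have h3 : ∑ j ∈ Finset.Iic k, (u k - u j) + ∑ j ∈ Finset.Iic k, u j
      = ∑ j ∈ Finset.Iic k, u k := by
    rw [← Finset.sum_add_distrib]
    apply Finset.sum_congr rfl
    intro j hj
    have := hu (Finset.mem_Iic.1 hj)
    omega
  have h4 : ∑ j ∈ Finset.Iic k, u k
      ≤ ∑ j ∈ Finset.Iic k, (u k - v j) + ∑ j ∈ Finset.Iic k, v j := by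
    rw [← Finset.sum_add_distrib]
    apply Finset.sum_le_sum
    intro j hj
    omega
  have := h (u k)
  omega

theorem main_aux {M : ℕ} (u₀ : Fin M → ℕ) (hu : Monotone u₀) (n : ℕ) (w : ℕ → Bool) :
    Monotone (applySeq u₀ w n) ∧ Monotone (oddMove^[n] u₀) ∧
      ∀ t, FF (oddMove^[n] u₀) t ≤ FF (applySeq u₀ w n) t := by
  induction n with
  | zero => exact ⟨hu, hu, fun t => le_rfl⟩
  | succ n ih =>
    obtain ⟨ha, hb, hc⟩ := ih
    rw [Function.iterate_succ_apply']
    refine ⟨?_, sortVec_mono _, ?_⟩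
    · unfold applySeq
      split_ifs
      · exact sortVec_mono _
      · exact sortVec_mono _
    · intro t
      cases t with
      | zero => simp [FF]
      | succ t =>
        have h1 := hc t
        have h2 := hc (t + 1)
        unfold applySeq
        rw [FF_odd _ hb]
        split_ifs
        · rw [FF_odd _ ha]; omega
        · rw [FF_even _ ha]; omega

theorem odd_strategy_optimal {M : ℕ} (u₀ : Fin M → ℕ) (hu : Monotone u₀)
    (n : ℕ) (w : ℕ → Bool) :
    PosLE (applySeq u₀ w n) (oddMove^[n] u₀) := by
  obtain ⟨ha, -, hc⟩ := main_aux u₀ hu n w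
  exact posLE_of_FF _ _ ha hc
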